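/- arXiv:1907.12463 — 3 statements merged into one kernel-verified Lean document; each statement's English description precedes it below -/
import Mathlib

section
/- Let d ≥ 3 and M ≥ 1 be integers, θ ∈ (0,π), ξ ∈ ℝ, and set a = cos(θ/2), b = exp(iξ)·sin(θ/2). For coefficients x : ({0,…,d−1})^M → ℂ with Σ_I |x_I|² = 1, define the 2×2 Hermitian matrix 𝔛(x) = Σ_{I ∈ ({0,…,d−2})^M} [[ |a|²·|x_I|², a·conj(b)·conj(x_I)·x_{I⊞1} ], [ conj(a)·b·x_I·conj(x_{I⊞1}), |b|²·|x_{I⊞1}|² ]], where I⊞1 denotes the multi-index obtained from I by adding 1 to every component. Then the supremum over all such normalized coefficient families x of the largest eigenvalue of 𝔛(x) equals (1/2)·(1 + √(1 − sin²θ·sin²(π/d))), independently of M. -/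
open Real Matrix

/-- Embedding of multi-indices with components in `{0,…,d−2}` into `{0,…,d−1}`. -/
def embQ (d M : ℕ) (I : Fin M → Fin (d - 1)) : Fin M → Fin d :=
  fun m => ⟨(I m).1, by have := (I m).2; omega⟩

/-- The multi-index `I ⊞ 1`, adding `1` to every component. -/
def embQ1 (d M : ℕ) (I : Fin M → Fin (d - 1)) : Fin M → Fin d :=
  fun m => ⟨(I m).1 + 1, by have := (I m).2; omega⟩

/-- The 2×2 Hermitian matrix `𝔛(x)` of Lemma 2. -/
noncomputable def XmatGES (d M : ℕ) (a b : ℂ) (x : (Fin M → Fin d) → ℂ) :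
    Matrix (Fin 2) (Fin 2) ℂ :=
  ∑ I : Fin M → Fin (d - 1),
    !![((‖a‖ ^ 2 * ‖x (embQ d M I)‖ ^ 2 : ℝ) : ℂ),
        a * starRingEnd ℂ b * starRingEnd ℂ (x (embQ d M I)) * x (embQ1 d M I);
      starRingEnd ℂ a * b * x (embQ d M I) * starRingEnd ℂ (x (embQ1 d M I)),
        ((‖b‖ ^ 2 * ‖x (embQ1 d M I)‖ ^ 2 : ℝ) : ℂ)]

/-- The largest eigenvalue of a (Hermitian) 2×2 matrix, as the supremum of its Rayleigh
quotient over unit vectors. -/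
noncomputable def lamMax2 (A : Matrix (Fin 2) (Fin 2) ℂ) : ℝ :=
  sSup {r : ℝ | ∃ v : Fin 2 → ℂ, (∑ s, ‖v s‖ ^ 2 = 1) ∧ r = ((star v) ⬝ᵥ (A.mulVec v)).re}

/-- The Rayleigh quotient of `XmatGES` is a sum of squares. -/
lemma rayleigh_XmatGES (d M : ℕ) (a b : ℂ) (x : (Fin M → Fin d) → ℂ) (v : Fin 2 → ℂ) :
    ((star v) ⬝ᵥ ((XmatGES d M a b x).mulVec v)).re =
      ∑ I : Fin M → Fin (d - 1), ‖starRingEnd ℂ a * v 0 * x (embQ d M I) +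
        starRingEnd ℂ b * v 1 * x (embQ1 d M I)‖ ^ 2 := by
  unfold XmatGES
  rw [Matrix.sum_mulVec, dotProduct_sum, Complex.re_sum]
  refine Finset.sum_congr rfl fun I _ => ?_
  rw [Complex.sq_norm, Complex.normSq_apply]
  simp only [dotProduct, Matrix.mulVec, Fin.sum_univ_two, Complex.sq_norm, Complex.normSq_apply,
    Pi.star_apply, RCLike.star_def, Matrix.of_apply, Matrix.cons_val', Matrix.cons_val_zero,
    Matrix.cons_val_one, Complex.add_re, Complex.add_im,
    Complex.mul_re, Complex.mul_im, Complex.conj_re, Complex.conj_im, Complex.ofReal_re,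
    Complex.ofReal_im]
  simp
  ring

lemma embQ_injective (d M : ℕ) : Function.Injective (embQ d M) := by
  intro I J h
  funext m
  have := congrArg Fin.val (congrFun h m)
  exact Fin.ext this

lemma embQ1_injective (d M : ℕ) : Function.Injective (embQ1 d M) := by
  intro I J h
  funext m
  have := congrArg Fin.val (congrFun h m)
  simp only [embQ1] at this
  exact Fin.ext (by omega)

/-- A sum of nonnegative terms decreases under reindexing by an injective map. -/
lemma sum_comp_le_sum_of_injective {ι κ : Type*} [Fintype ι] [Fintype κ] (e : ι → κ)
    (he : Function.Injective e) (F : κ → ℝ) (hF : ∀ j, 0 ≤ F j) :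
    ∑ i, F (e i) ≤ ∑ j, F j := by
  classical
  rw [← Finset.sum_image (s := Finset.univ) (f := F) (g := e) (fun _ _ _ _ h => he h)]
  exact Finset.sum_le_sum_of_subset_of_nonneg (Finset.subset_univ _) fun j _ _ => hF j

/-- The entries `sin (kπ/d)` of the top eigenvector of the path on `d - 1` vertices. -/
noncomputable def pathSin (d k : ℕ) : ℝ := Real.sin (k * (π / d))

lemma pathSin_zero (d : ℕ) : pathSin d 0 = 0 := by simp [pathSin]

lemma pathSin_self {d : ℕ} (hd : 0 < d) : pathSin d d = 0 := by
  have : (d : ℝ) ≠ 0 := by positivity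
  rw [pathSin, mul_div_cancel₀ _ this, Real.sin_pi]

lemma pathSin_pos {d k : ℕ} (hk : 0 < k) (hkd : k < d) : 0 < pathSin d k := by
  have h0 : (0 : ℝ) < d := by exact_mod_cast (by omega : 0 < d)
  have hk' : (0 : ℝ) < k := by exact_mod_cast hk
  have hkd' : (k : ℝ) < d := by exact_mod_cast hkd
  apply Real.sin_pos_of_pos_of_lt_pi
  · positivity
  · rw [← mul_div_assoc, div_lt_iff₀ h0]
    nlinarith [Real.pi_pos]

lemma pathSin_nonneg {d k : ℕ} (hkd : k ≤ d) : 0 ≤ pathSin d k := by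
  rcases Nat.eq_zero_or_pos k with rfl | hk
  · rw [pathSin_zero]
  · rcases hkd.eq_or_lt with rfl | h
    · rw [pathSin_self hk]
    · exact (pathSin_pos hk h).le

lemma pathSin_add_pathSin (d k : ℕ) :
    pathSin d k + pathSin d (k + 2) = 2 * Real.cos (π / d) * pathSin d (k + 1) := by
  unfold pathSin
  have h1 : ((k : ℕ) : ℝ) * (π / d) = ((k + 1 : ℕ) : ℝ) * (π / d) - π / d := by push_cast; ring
  have h2 : ((k + 2 : ℕ) : ℝ) * (π / d) = ((k + 1 : ℕ) : ℝ) * (π / d) + π / d := by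
    push_cast; ring
  rw [h1, h2, Real.sin_sub, Real.sin_add]
  ring

/-- The top singular vector of the bidiagonal matrix with entries `α`, `β`. -/
noncomputable def pathVec (d : ℕ) (α β : ℝ) (k : ℕ) : ℝ :=
  α * pathSin d (k + 1) + β * pathSin d k

lemma pathVec_edge (d : ℕ) (α β : ℝ) (k : ℕ) :
    α * pathVec d α β k + β * pathVec d α β (k + 1) =
      (α ^ 2 + β ^ 2 + 2 * α * β * Real.cos (π / d)) * pathSin d (k + 1) := by
  have := pathSin_add_pathSin d k
  unfold pathVec
  linear_combination α * β * this

lemma pathVec_pos {d : ℕ} (hd : 2 ≤ d) {α β : ℝ} (hα : 0 < α) (hβ : 0 < β) {k : ℕ}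
    (hk : k < d) : 0 < pathVec d α β k := by
  unfold pathVec
  rcases Nat.eq_zero_or_pos k with rfl | h
  · rw [pathSin_zero]
    have := pathSin_pos (d := d) (k := 0 + 1) (by omega) (by omega)
    positivity
  · have h1 := pathSin_pos h hk
    have h2 := pathSin_nonneg (d := d) (k := k + 1) (by omega)
    positivity

lemma sum_pathVec_sq (n : ℕ) (α β : ℝ) :
    ∑ k ∈ Finset.range (n + 1), pathVec (n + 1) α β k ^ 2 =
      (α ^ 2 + β ^ 2 + 2 * α * β * Real.cos (π / (n + 1 : ℕ))) *
        ∑ k ∈ Finset.range n, pathSin (n + 1) (k + 1) ^ 2 := by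
  have h : ∀ k, pathVec (n + 1) α β k ^ 2 =
      α * (pathSin (n + 1) (k + 1) * pathVec (n + 1) α β k) +
      β * (pathSin (n + 1) k * pathVec (n + 1) α β k) := by
    intro k
    simp only [pathVec]
    ring
  simp_rw [h]
  rw [Finset.sum_add_distrib, Finset.sum_range_succ, Finset.sum_range_succ' _ n, pathSin_zero,
    pathSin_self (Nat.succ_pos n), Finset.mul_sum]
  simp only [zero_mul, mul_zero, add_zero]
  rw [← Finset.sum_add_distrib]
  refine Finset.sum_congr rfl fun k _ => ?_
  linear_combination pathSin (n + 1) (k + 1) * pathVec_edge (n + 1) α β k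

lemma weighted_sq_le {α β y z A B : ℝ} (hα : 0 ≤ α) (hβ : 0 ≤ β) (hy : 0 < y) (hz : 0 < z) :
    (α * A + β * B) ^ 2 ≤ (α * y + β * z) * (α * A ^ 2 / y + β * B ^ 2 / z) := by
  have h : (α * y + β * z) * (α * A ^ 2 / y + β * B ^ 2 / z) - (α * A + β * B) ^ 2 =
      α * β * (A * z - B * y) ^ 2 / (y * z) := by
    field_simp
    ring
  have : 0 ≤ α * β * (A * z - B * y) ^ 2 / (y * z) := by positivity
  linarith

lemma sum_edges_le (d M : ℕ) (hd : 3 ≤ d) (hM : 1 ≤ M) (α β : ℝ) (hα : 0 ≤ α) (hβ : 0 ≤ β)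
    (r : (Fin M → Fin d) → ℝ) :
    ∑ I : Fin M → Fin (d - 1), (α * r (embQ d M I) + β * r (embQ1 d M I)) ^ 2 ≤
      (α ^ 2 + β ^ 2 + 2 * α * β * Real.cos (π / d)) * ∑ J, r J ^ 2 := by
  by_cases hab : α * β = 0
  · have h1 := sum_comp_le_sum_of_injective _ (embQ_injective d M) (fun J => r J ^ 2)
      (fun J => sq_nonneg _)
    have h2 := sum_comp_le_sum_of_injective _ (embQ1_injective d M) (fun J => r J ^ 2)
      (fun J => sq_nonneg _)
    have h3 : ∀ I : Fin M → Fin (d - 1), (α * r (embQ d M I) + β * r (embQ1 d M I)) ^ 2 =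
        α ^ 2 * r (embQ d M I) ^ 2 + β ^ 2 * r (embQ1 d M I) ^ 2 := by
      intro I
      linear_combination 2 * r (embQ d M I) * r (embQ1 d M I) * hab
    simp_rw [h3]
    rw [Finset.sum_add_distrib, ← Finset.mul_sum, ← Finset.mul_sum]
    have h4 : 2 * α * β * Real.cos (π / d) = 0 := by
      linear_combination 2 * Real.cos (π / d) * hab
    rw [h4, add_zero, add_mul]
    exact add_le_add (mul_le_mul_of_nonneg_left h1 (sq_nonneg α))
      (mul_le_mul_of_nonneg_left h2 (sq_nonneg β))
  · have hα' : 0 < α := hα.lt_of_ne fun h => hab (by rw [← h, zero_mul])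
    have hβ' : 0 < β := hβ.lt_of_ne fun h => hab (by rw [← h, mul_zero])
    set l := α ^ 2 + β ^ 2 + 2 * α * β * Real.cos (π / d) with hl
    have hl0 : 0 ≤ l := by
      have := Real.neg_one_le_cos (π / d)
      nlinarith [sq_nonneg (α - β), mul_pos hα' hβ']
    let m : Fin M := ⟨0, hM⟩
    let y : (Fin M → Fin d) → ℝ := fun J => pathVec d α β (J m)
    have hy : ∀ J, 0 < y J := fun J => pathVec_pos (by omega) hα' hβ' (J m).2
    let F : (Fin M → Fin d) → ℝ := fun J => l * (α * pathSin d ((J m : ℕ) + 1) / y J) * r J ^ 2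
    let G : (Fin M → Fin d) → ℝ := fun J => l * (β * pathSin d (J m : ℕ) / y J) * r J ^ 2
    have hF : ∀ J, 0 ≤ F J := fun J => by
      have h1 := hy J
      have h2 := pathSin_nonneg (d := d) (k := (J m : ℕ) + 1) (J m).2
      positivity
    have hG : ∀ J, 0 ≤ G J := fun J => by
      have h1 := hy J
      have h2 := pathSin_nonneg (d := d) (k := (J m : ℕ)) (J m).2.le
      positivity
    have h1 := sum_comp_le_sum_of_injective _ (embQ_injective d M) F hF
    have h2 := sum_comp_le_sum_of_injective _ (embQ1_injective d M) G hG
    have h3 : ∑ J, F J + ∑ J, G J = l * ∑ J, r J ^ 2 := by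
      rw [← Finset.sum_add_distrib, Finset.mul_sum]
      refine Finset.sum_congr rfl fun J _ => ?_
      have h4 : α * pathSin d ((J m : ℕ) + 1) / y J + β * pathSin d (J m : ℕ) / y J = 1 := by
        rw [← add_div]
        exact div_self (hy J).ne'
      simp only [F, G]
      linear_combination l * r J ^ 2 * h4
    rw [← h3]
    refine le_trans ?_ (add_le_add h1 h2)
    rw [← Finset.sum_add_distrib]
    refine Finset.sum_le_sum fun I _ => ?_
    refine (weighted_sq_le hα hβ (hy (embQ d M I)) (hy (embQ1 d M I))).trans (le_of_eq ?_)
    have h5 : α * y (embQ d M I) + β * y (embQ1 d M I) = l * pathSin d ((I m : ℕ) + 1) :=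
      pathVec_edge d α β (I m)
    rw [h5]
    simp only [F, G, embQ, embQ1]
    ring

lemma quadratic_le (θ C p q : ℝ) (hpq : p ^ 2 + q ^ 2 = 1) :
    (Real.cos (θ / 2) * p) ^ 2 + (Real.sin (θ / 2) * q) ^ 2 +
      2 * (Real.cos (θ / 2) * p) * (Real.sin (θ / 2) * q) * C ≤
      1 / 2 * (1 + Real.sqrt (Real.cos θ ^ 2 + Real.sin θ ^ 2 * C ^ 2)) := by
  have hc : Real.cos θ = 2 * Real.cos (θ / 2) ^ 2 - 1 := by
    rw [← Real.cos_two_mul]; congr 1; ring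
  have hs : Real.sin θ = 2 * Real.sin (θ / 2) * Real.cos (θ / 2) := by
    rw [← Real.sin_two_mul]; congr 1; ring
  have h1 := Real.sin_sq_add_cos_sq (θ / 2)
  have h2 : Real.cos θ * (p ^ 2 - q ^ 2) + Real.sin θ * C * (2 * p * q) ≤
      Real.sqrt (Real.cos θ ^ 2 + Real.sin θ ^ 2 * C ^ 2) := by
    apply Real.le_sqrt_of_sq_le
    have h3 : (p ^ 2 - q ^ 2) ^ 2 + (2 * p * q) ^ 2 = 1 := by
      linear_combination (p ^ 2 + q ^ 2 + 1) * hpq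
    have h4 : Real.cos θ ^ 2 + Real.sin θ ^ 2 * C ^ 2 -
        (Real.cos θ * (p ^ 2 - q ^ 2) + Real.sin θ * C * (2 * p * q)) ^ 2 =
        (Real.cos θ * (2 * p * q) - Real.sin θ * C * (p ^ 2 - q ^ 2)) ^ 2 := by
      linear_combination -(Real.cos θ ^ 2 + Real.sin θ ^ 2 * C ^ 2) * h3
    nlinarith [sq_nonneg (Real.cos θ * (2 * p * q) - Real.sin θ * C * (p ^ 2 - q ^ 2))]
  rw [hc, hs] at h2
  rw [hc, hs]
  have h5 : Real.sin (θ / 2) ^ 2 = 1 - Real.cos (θ / 2) ^ 2 := by linarith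
  have h6 : q ^ 2 = 1 - p ^ 2 := by linarith
  nlinarith [h2, h5, h6]

lemma exists_quadratic_eq (θ C : ℝ) :
    ∃ p q : ℝ, p ^ 2 + q ^ 2 = 1 ∧
      (Real.cos (θ / 2) * p) ^ 2 + (Real.sin (θ / 2) * q) ^ 2 +
      2 * (Real.cos (θ / 2) * p) * (Real.sin (θ / 2) * q) * C =
      1 / 2 * (1 + Real.sqrt (Real.cos θ ^ 2 + Real.sin θ ^ 2 * C ^ 2)) := by
  have hc : Real.cos θ = 2 * Real.cos (θ / 2) ^ 2 - 1 := by
    rw [← Real.cos_two_mul]; congr 1; ring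
  have hs : Real.sin θ = 2 * Real.sin (θ / 2) * Real.cos (θ / 2) := by
    rw [← Real.sin_two_mul]; congr 1; ring
  have h1 := Real.sin_sq_add_cos_sq (θ / 2)
  let z : ℂ := ⟨Real.cos θ, Real.sin θ * C⟩
  have hn : ‖z‖ = Real.sqrt (Real.cos θ ^ 2 + Real.sin θ ^ 2 * C ^ 2) := by
    rw [Complex.norm_def, Complex.normSq_apply]
    congr 1
    simp only [z]
    ring
  rw [← hn]
  have hre : Real.cos θ = ‖z‖ * Real.cos (2 * (z.arg / 2)) := by
    rw [mul_div_cancel₀ _ two_ne_zero, Complex.norm_mul_cos_arg]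
  have him : Real.sin θ * C = ‖z‖ * Real.sin (2 * (z.arg / 2)) := by
    rw [mul_div_cancel₀ _ two_ne_zero, Complex.norm_mul_sin_arg]
  have h3 := Real.sin_sq_add_cos_sq (z.arg / 2)
  have h4 := Real.sin_sq_add_cos_sq (2 * (z.arg / 2))
  refine ⟨Real.cos (z.arg / 2), Real.sin (z.arg / 2), by linarith, ?_⟩
  have hp := Real.cos_two_mul (z.arg / 2)
  have hq := Real.sin_two_mul (z.arg / 2)
  have h5 : Real.cos θ * Real.cos (2 * (z.arg / 2)) +
      Real.sin θ * C * Real.sin (2 * (z.arg / 2)) = ‖z‖ := by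
    rw [hre, him]
    linear_combination ‖z‖ * h4
  rw [← h5, hp, hq, hc, hs]
  have h6 : Real.sin (θ / 2) ^ 2 = 1 - Real.cos (θ / 2) ^ 2 := by linarith
  have h7 : Real.sin (z.arg / 2) ^ 2 = 1 - Real.cos (z.arg / 2) ^ 2 := by linarith
  rw [mul_pow, mul_pow, h6, h7]
  ring

/-- The family supported on the main diagonal of the multi-index cube. -/
noncomputable def diagFamily (d M : ℕ) (m : Fin M) (y : ℕ → ℝ) (J : Fin M → Fin d) : ℂ :=
  open Classical in if J = (fun _ => J m) then (y (J m) : ℂ) else 0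

lemma diagFamily_const (d M : ℕ) (m : Fin M) (y : ℕ → ℝ) (k : Fin d) :
    diagFamily d M m y (fun _ => k) = y k := by
  simp [diagFamily]

lemma sum_norm_sq_diagFamily (d M : ℕ) (m : Fin M) (y : ℕ → ℝ) :
    ∑ J, ‖diagFamily d M m y J‖ ^ 2 = ∑ k ∈ Finset.range d, y k ^ 2 := by
  rw [← Fin.sum_univ_eq_sum_range (fun k => y k ^ 2)]
  symm
  refine Fintype.sum_of_injective (fun (k : Fin d) (_ : Fin M) => k)
    (fun i j h => congrFun h m) _ _ ?_ ?_
  · intro J hJ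
    have : J ≠ fun _ => J m := fun h => hJ ⟨J m, h.symm⟩
    simp [diagFamily, this]
  · intro k
    simp [diagFamily]

lemma le_sum_edges_diagFamily (d M : ℕ) (m : Fin M) (y : ℕ → ℝ) (α β : ℝ) :
    ∑ k ∈ Finset.range (d - 1), (α * y k + β * y (k + 1)) ^ 2 ≤
      ∑ I, ‖(α : ℂ) * diagFamily d M m y (embQ d M I) +
        (β : ℂ) * diagFamily d M m y (embQ1 d M I)‖ ^ 2 := by
  rw [← Fin.sum_univ_eq_sum_range (fun k => (α * y k + β * y (k + 1)) ^ 2)]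
  refine le_trans (le_of_eq ?_) (sum_comp_le_sum_of_injective
    (fun (k : Fin (d - 1)) (_ : Fin M) => k) (fun i j h => congrFun h m) _
    (fun J => sq_nonneg _))
  refine Finset.sum_congr rfl fun k _ => ?_
  have h : (α : ℂ) * diagFamily d M m y (embQ d M fun _ => k) +
      (β : ℂ) * diagFamily d M m y (embQ1 d M fun _ => k) =
      ((α * y k + β * y (k + 1) : ℝ) : ℂ) := by
    have h1 : diagFamily d M m y (embQ d M fun _ => k) = y k :=
      diagFamily_const d M m y ⟨k, by omega⟩
    have h2 : diagFamily d M m y (embQ1 d M fun _ => k) = y (k + 1) :=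
      diagFamily_const d M m y ⟨k + 1, by omega⟩
    rw [h1, h2]
    push_cast
    rfl
  rw [h, Complex.norm_real, Real.norm_eq_abs, sq_abs]

theorem stmt3 (d M : ℕ) (hd : 3 ≤ d) (hM : 1 ≤ M) (θ ξ : ℝ) (hθ : θ ∈ Set.Ioo 0 π)
    (a b : ℂ) (ha : a = (Real.cos (θ / 2) : ℝ))
    (hb : b = Complex.exp (Complex.I * ξ) * (Real.sin (θ / 2) : ℝ)) :
    sSup {r : ℝ | ∃ x : (Fin M → Fin d) → ℂ, (∑ I, ‖x I‖ ^ 2 = 1) ∧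
        r = lamMax2 (XmatGES d M a b x)}
      = (1 / 2) * (1 + Real.sqrt (1 - Real.sin θ ^ 2 * Real.sin (π / d) ^ 2)) := by
  have hθ1 : 0 < θ := hθ.1
  have hθ2 : θ < π := hθ.2
  have hc0 : 0 ≤ Real.cos (θ / 2) :=
    (Real.cos_pos_of_mem_Ioo ⟨by linarith, by linarith⟩).le
  have hs0 : 0 ≤ Real.sin (θ / 2) :=
    (Real.sin_pos_of_pos_of_lt_pi (by linarith) (by linarith)).le
  have hR : 1 - Real.sin θ ^ 2 * Real.sin (π / d) ^ 2 =
      Real.cos θ ^ 2 + Real.sin θ ^ 2 * Real.cos (π / d) ^ 2 := by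
    rw [Real.sin_sq (π / d), Real.cos_sq' θ]
    ring
  rw [hR]
  have hexp : ‖Complex.exp (Complex.I * ξ)‖ = 1 := by
    rw [mul_comm, Complex.norm_exp_ofReal_mul_I]
  have hna : ‖a‖ = Real.cos (θ / 2) := by
    rw [ha, Complex.norm_real, Real.norm_of_nonneg hc0]
  have hnb : ‖b‖ = Real.sin (θ / 2) := by
    rw [hb, norm_mul, hexp, one_mul, Complex.norm_real, Real.norm_of_nonneg hs0]
  set L := 1 / 2 * (1 + Real.sqrt (Real.cos θ ^ 2 + Real.sin θ ^ 2 * Real.cos (π / d) ^ 2))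
    with hL
  have hL0 : 0 < L := by positivity
  have hup : ∀ x : (Fin M → Fin d) → ℂ, ∑ I, ‖x I‖ ^ 2 = 1 → ∀ v : Fin 2 → ℂ,
      ∑ s, ‖v s‖ ^ 2 = 1 → ((star v) ⬝ᵥ ((XmatGES d M a b x).mulVec v)).re ≤ L := by
    intro x hx v hv
    rw [Fin.sum_univ_two] at hv
    have h1 := sum_edges_le d M hd hM (Real.cos (θ / 2) * ‖v 0‖) (Real.sin (θ / 2) * ‖v 1‖)
      (by positivity) (by positivity) (fun J => ‖x J‖)
    rw [hx, mul_one] at h1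
    rw [rayleigh_XmatGES]
    refine le_trans (Finset.sum_le_sum fun I _ => ?_) (h1.trans (quadratic_le θ _ _ _ hv))
    refine pow_le_pow_left₀ (norm_nonneg _) ((norm_add_le _ _).trans (le_of_eq ?_)) 2
    simp only [norm_mul, RCLike.norm_conj, hna, hnb]
  have hupper : ∀ x : (Fin M → Fin d) → ℂ, ∑ I, ‖x I‖ ^ 2 = 1 →
      lamMax2 (XmatGES d M a b x) ≤ L := by
    intro x hx
    refine csSup_le ⟨_, ![1, 0], by simp, rfl⟩ ?_
    rintro r ⟨v, hv, rfl⟩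
    exact hup x hx v hv
  obtain ⟨p, q, hpq, hval⟩ := exists_quadratic_eq θ (Real.cos (π / d))
  rw [← hL] at hval
  clear_value L
  set α := Real.cos (θ / 2) * p with hα
  set β := Real.sin (θ / 2) * q with hβ
  let m : Fin M := ⟨0, hM⟩
  obtain ⟨W, hWsum⟩ : ∃ W, ∑ k ∈ Finset.range (d - 1), pathSin d (k + 1) ^ 2 = W := ⟨_, rfl⟩
  have hW : 0 < W := hWsum ▸ Finset.sum_pos
    (fun k hk => pow_pos (pathSin_pos (Nat.succ_pos k) (by simp at hk; omega)) 2)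
    ⟨0, by simp; omega⟩
  have hY : ∑ k ∈ Finset.range d, pathVec d α β k ^ 2 = L * W := by
    have hdn : d = d - 1 + 1 := by omega
    have h := sum_pathVec_sq (d - 1) α β
    rwa [← hdn, hval, hWsum] at h
  let y : ℕ → ℝ := fun k => pathVec d α β k / Real.sqrt (L * W)
  have hsq : Real.sqrt (L * W) ^ 2 = L * W := Real.sq_sqrt (mul_pos hL0 hW).le
  let x := diagFamily d M m y
  have hx : ∑ I, ‖x I‖ ^ 2 = 1 := by
    rw [sum_norm_sq_diagFamily]
    simp only [y, div_pow, hsq]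
    rw [← Finset.sum_div, hY, div_self (mul_pos hL0 hW).ne']
  let v : Fin 2 → ℂ := ![(p : ℂ), Complex.exp (Complex.I * ξ) * q]
  have hv : ∑ s, ‖v s‖ ^ 2 = 1 := by
    simp [v, Fin.sum_univ_two, hexp, hpq]
  have hlow : L ≤ ((star v) ⬝ᵥ ((XmatGES d M a b x).mulVec v)).re := by
    rw [rayleigh_XmatGES]
    have h0 : starRingEnd ℂ a * v 0 = (α : ℂ) := by
      rw [ha, Complex.conj_ofReal]
      simp [v, hα]
    have h1 : starRingEnd ℂ b * v 1 = (β : ℂ) := by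
      have he : starRingEnd ℂ (Complex.exp (Complex.I * ξ)) * Complex.exp (Complex.I * ξ) = 1 := by
        rw [← Complex.normSq_eq_conj_mul_self, Complex.normSq_eq_norm_sq, hexp]
        simp
      rw [hb, map_mul, Complex.conj_ofReal]
      simp only [v, Matrix.cons_val_one, Matrix.cons_val_fin_one, hβ]
      push_cast
      linear_combination Complex.sin (θ / 2) * q * he
    rw [h0, h1]
    refine le_trans (le_of_eq ?_) (le_sum_edges_diagFamily d M m y α β)
    have h2 : ∀ k, (α * y k + β * y (k + 1)) ^ 2 = L / W * pathSin d (k + 1) ^ 2 := by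
      intro k
      have h3 : α * y k + β * y (k + 1) = L * pathSin d (k + 1) / Real.sqrt (L * W) := by
        rw [← hval, ← pathVec_edge]
        simp only [y]
        rw [hval]
        ring
      rw [h3, div_pow, hsq]
      field_simp
    simp_rw [h2]
    rw [← Finset.mul_sum, hWsum]
    exact (div_mul_cancel₀ L hW.ne').symm
  apply le_antisymm
  · refine csSup_le ⟨_, x, hx, rfl⟩ ?_
    rintro r ⟨x, hx, rfl⟩
    exact hupper x hx
  · refine le_csSup_of_le ⟨L, ?_⟩ ⟨x, hx, rfl⟩ (le_csSup_of_le ⟨L, ?_⟩ ⟨v, hv, rfl⟩ hlow)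
    · rintro r ⟨x, hx, rfl⟩
      exact hupper x hx
    · rintro r ⟨v, hv, rfl⟩
      exact hup x hx v hv
end

section
/- Let D > d_G ≥ 1 be integers, let P be a D×D complex matrix that is an orthogonal projection (P = P* = P²) of rank d_G, let ε ∈ (0,1) satisfy (1−ε)·D > d_G, and define the Hermitian matrix W = ((1−ε)·I − P)/((1−ε)·D − d_G). Then: (a) for every unit vector ψ ∈ ℂ^D with ⟨ψ, (I−P)ψ⟩ ≥ ε one has ⟨ψ, Wψ⟩ ≥ 0; and (b) for every positive semidefinite D×D matrix σ with trace 1 satisfying P·σ = σ, and every p ∈ [0,1], the state γ(p) = (1−p)·σ + (p/D)·I satisfies tr(W·γ(p)) = ( p·(D − d_G)/D − ε ) / ((1−ε)·D − d_G); in particular tr(W·γ(p)) < 0 if and only if p < D·ε/(D − d_G). -/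
open Matrix
open scoped ComplexOrder

theorem stmt12 (D dG : ℕ) (hdG : 1 ≤ dG) (hD : dG < D)
    (P : Matrix (Fin D) (Fin D) ℂ) (hP1 : P.IsHermitian) (hP2 : P * P = P)
    (hPtr : P.trace = (dG : ℂ)) (ε : ℝ) (hε : ε ∈ Set.Ioo (0 : ℝ) 1)
    (hεD : (dG : ℝ) < (1 - ε) * D)
    (W : Matrix (Fin D) (Fin D) ℂ)
    (hW : W = ((1 : ℝ) / ((1 - ε) * D - dG)) •
      ((1 - ε) • (1 : Matrix (Fin D) (Fin D) ℂ) - P)) :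
    (∀ ψ : Fin D → ℂ, (∑ i, ‖ψ i‖ ^ 2 = 1) →
      ε ≤ ((star ψ) ⬝ᵥ ((1 - P).mulVec ψ)).re → 0 ≤ ((star ψ) ⬝ᵥ (W.mulVec ψ)).re) ∧
    (∀ σ : Matrix (Fin D) (Fin D) ℂ, σ.PosSemidef → σ.trace = 1 → P * σ = σ →
      ∀ p : ℝ, p ∈ Set.Icc (0 : ℝ) 1 →
        (W * ((1 - p) • σ + (p / (D : ℝ)) • (1 : Matrix (Fin D) (Fin D) ℂ))).trace
          = (((p * ((D : ℝ) - dG) / D - ε) / ((1 - ε) * D - dG) : ℝ) : ℂ) ∧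
        (((W * ((1 - p) • σ + (p / (D : ℝ)) • (1 : Matrix (Fin D) (Fin D) ℂ))).trace).re < 0 ↔
          p < (D : ℝ) * ε / ((D : ℝ) - dG))) := by
  have hc : 0 < (1 - ε) * (D : ℝ) - dG := sub_pos.mpr hεD
  have hDG : 0 < (D : ℝ) - dG := sub_pos.mpr (Nat.cast_lt.mpr hD)
  have hD0 : 0 < (D : ℝ) := Nat.cast_pos.mpr (by lia)
  refine ⟨fun ψ hψ hψε => ?_, fun σ _ hσtr hPσ p _ => ?_⟩
  · have hnorm : (star ψ ⬝ᵥ ψ).re = 1 := by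
      rw [← hψ]
      simp [dotProduct, ← Complex.normSq_eq_norm_sq, Complex.normSq_apply]
    have hWP : W = ((1 : ℝ) / ((1 - ε) * D - dG)) •
        ((1 - P) - ε • (1 : Matrix (Fin D) (Fin D) ℂ)) := by
      rw [hW]
      module
    rw [hWP, smul_mulVec, sub_mulVec, smul_mulVec, one_mulVec, dotProduct_smul, dotProduct_sub,
      dotProduct_smul, Complex.smul_re, Complex.sub_re, Complex.smul_re, hnorm]
    simp only [smul_eq_mul, mul_one]
    exact mul_nonneg (by positivity) (sub_nonneg.mpr hψε)
  · have htr : (W * ((1 - p) • σ + (p / (D : ℝ)) • (1 : Matrix (Fin D) (Fin D) ℂ))).trace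
        = (((p * ((D : ℝ) - dG) / D - ε) / ((1 - ε) * D - dG) : ℝ) : ℂ) := by
      have hcC : (1 - (ε : ℂ)) * D - dG ≠ 0 := by exact_mod_cast hc.ne'
      have hDC : (D : ℂ) ≠ 0 := by exact_mod_cast hD0.ne'
      rw [hW]
      simp only [smul_mul_assoc, mul_add, mul_smul_comm, mul_one, sub_mul, one_mul, hPσ,
        trace_smul, trace_add, trace_sub, hσtr, hPtr, trace_one, Fintype.card_fin,
        Complex.real_smul]
      push_cast
      field_simp
      ring
    refine ⟨htr, ?_⟩
    rw [htr, Complex.ofReal_re, div_lt_iff₀ hc, zero_mul, sub_neg, div_lt_iff₀ hD0,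
      lt_div_iff₀ hDG, mul_comm ε]
end

section
/- Let N ≥ 2 and d ≥ 2 be integers, θ ∈ (0,π), ξ ∈ ℝ, a = cos(θ/2), b = exp(iξ)·sin(θ/2). In the ℓ² space of functions Fin 2 × ((Fin (N−1)) → Fin d) → ℂ, the family of vectors Φ_I = a·e_{(0,I)} + b·e_{(1,I⊞1)}, indexed by multi-indices I : Fin (N−1) → {0,…,d−2} (where I⊞1 adds 1 to every component of I), is orthonormal. Consequently the subspace S_{2×d^{N−1}}^θ = span{Φ_I} has dimension (d−1)^{N−1}. -/
open Real

/-- Embedding of multi-indices with components in `{0,…,d−2}` into `{0,…,d−1}`. -/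
def embF (N d : ℕ) (I : Fin (N - 1) → Fin (d - 1)) : Fin (N - 1) → Fin d :=
  fun m => ⟨(I m).1, by have := (I m).2; omega⟩

/-- The multi-index `I ⊞ 1`, adding `1` to every component. -/
def embF1 (N d : ℕ) (I : Fin (N - 1) → Fin (d - 1)) : Fin (N - 1) → Fin d :=
  fun m => ⟨(I m).1 + 1, by have := (I m).2; omega⟩

/-- The vectors `Φ_I = a·e_{(0,I)} + b·e_{(1,I⊞1)}` spanning `S_{2×d^{N−1}}^θ`. -/
noncomputable def PhiGES (N d : ℕ) (a b : ℂ) (I : Fin (N - 1) → Fin (d - 1)) :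
    EuclideanSpace ℂ (Fin 2 × (Fin (N - 1) → Fin d)) :=
  a • EuclideanSpace.single ((0 : Fin 2), embF N d I) (1 : ℂ)
    + b • EuclideanSpace.single ((1 : Fin 2), embF1 N d I) (1 : ℂ)

theorem embF_injective (N d : ℕ) : Function.Injective (embF N d) := by
  intro I J h
  ext m
  exact Fin.mk.inj (congrFun h m)

theorem embF1_injective (N d : ℕ) : Function.Injective (embF1 N d) := by
  intro I J h
  ext m
  exact Nat.succ.inj (congrArg Fin.val (congrFun h m))

/-- If `|a|² + |b|² = 1`, the vectors `Φ_I` are orthonormal. -/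
theorem orthonormal_PhiGES (N d : ℕ) {a b : ℂ}
    (hab : starRingEnd ℂ a * a + starRingEnd ℂ b * b = 1) :
    Orthonormal ℂ (PhiGES N d a b) := by
  rw [orthonormal_iff_ite]
  intro I J
  have h0 : embF N d I = embF N d J ↔ I = J := (embF_injective N d).eq_iff
  have h1 : embF1 N d I = embF1 N d J ↔ I = J := (embF1_injective N d).eq_iff
  simp only [PhiGES, inner_add_left, inner_add_right, inner_smul_left, inner_smul_right,
    EuclideanSpace.inner_single_left, PiLp.single_apply, Prod.mk.injEq, h0, h1]
  by_cases hIJ : I = J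
  · simp [hIJ]
    linear_combination hab
  · simp [hIJ]

theorem stmt18 (N d : ℕ) (hN : 2 ≤ N) (hd : 2 ≤ d) (θ ξ : ℝ) (hθ : θ ∈ Set.Ioo 0 π)
    (a b : ℂ) (ha : a = (Real.cos (θ / 2) : ℝ))
    (hb : b = Complex.exp (Complex.I * ξ) * (Real.sin (θ / 2) : ℝ)) :
    Orthonormal ℂ (PhiGES N d a b) ∧
    Module.finrank ℂ (Submodule.span ℂ (Set.range (PhiGES N d a b))) = (d - 1) ^ (N - 1) := by
  have hab : starRingEnd ℂ a * a + starRingEnd ℂ b * b = 1 := by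
    have hexp : starRingEnd ℂ (Complex.exp (Complex.I * ξ)) * Complex.exp (Complex.I * ξ) = 1 := by
      rw [← Complex.exp_conj, ← Complex.exp_add]
      simp
    have hcs : ((Real.sin (θ / 2) : ℝ) : ℂ) ^ 2 + ((Real.cos (θ / 2) : ℝ) : ℂ) ^ 2 = 1 := by
      exact_mod_cast Real.sin_sq_add_cos_sq (θ / 2)
    rw [ha, hb, map_mul, Complex.conj_ofReal, Complex.conj_ofReal]
    linear_combination ((Real.sin (θ / 2) : ℝ) : ℂ) ^ 2 * hexp + hcs
  have hΦ := orthonormal_PhiGES N d hab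
  refine ⟨hΦ, ?_⟩
  rw [finrank_span_eq_card hΦ.linearIndependent]
  simp
end
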